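/- arXiv:1909.12059 — 2 statements merged into one kernel-verified Lean document; each statement's English description precedes it below -/
import Mathlib

section
/- Let P : ℂ² → ℂ be defined by P(z₁, z₂) = z₂·conj(z₁)·conj(z₂)² + i·z₁·conj(z₁)²·conj(z₂). Then for every (z₁, z₂) ∈ ℂ² with (z₁, z₂) ≠ (0, 0), the two vectors (z₁, z₂) and ((∂P/∂z̄₁)(z₁,z₂), (∂P/∂z̄₂)(z₁,z₂)) in ℂ² are linearly independent over ℂ, where ∂P/∂z̄₁ and ∂P/∂z̄₂ denote the conjugate Wirtinger derivatives of P. -/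
open ComplexConjugate

/-- The conjugate Wirtinger derivative of `g : ℂ² → ℂ` with respect to the first
coordinate: `∂g/∂z̄₁ (z) = (1/2)(Dg(z)(e₁) + i · Dg(z)(i·e₁))`. -/
noncomputable def wirtingerBarFst (g : ℂ × ℂ → ℂ) (z : ℂ × ℂ) : ℂ :=
  (1 / 2 : ℂ) * (fderiv ℝ g z (1, 0) + Complex.I * fderiv ℝ g z (Complex.I, 0))

/-- The conjugate Wirtinger derivative of `g : ℂ² → ℂ` with respect to the second
coordinate: `∂g/∂z̄₂ (z) = (1/2)(Dg(z)(e₂) + i · Dg(z)(i·e₂))`. -/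
noncomputable def wirtingerBarSnd (g : ℂ × ℂ → ℂ) (z : ℂ × ℂ) : ℂ :=
  (1 / 2 : ℂ) * (fderiv ℝ g z (0, 1) + Complex.I * fderiv ℝ g z (0, Complex.I))

/-- The Wirtinger derivatives of `z₂ z̄₁ z̄₂² + i z₁ z̄₁² z̄₂`. -/
theorem wirtingerBar_polynomial (z : ℂ × ℂ) :
    wirtingerBarFst (fun z =>
      z.2 * conj z.1 * (conj z.2) ^ 2 + Complex.I * z.1 * (conj z.1) ^ 2 * conj z.2) z =
        z.2 * (conj z.2) ^ 2 + 2 * Complex.I * z.1 * conj z.1 * conj z.2 ∧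
    wirtingerBarSnd (fun z =>
      z.2 * conj z.1 * (conj z.2) ^ 2 + Complex.I * z.1 * (conj z.1) ^ 2 * conj z.2) z =
        2 * z.2 * conj z.1 * conj z.2 + Complex.I * z.1 * (conj z.1) ^ 2 := by
  have h1 : HasFDerivAt (fun z : ℂ × ℂ => z.1) (ContinuousLinearMap.fst ℝ ℂ ℂ) z :=
    hasFDerivAt_fst
  have h2 : HasFDerivAt (fun z : ℂ × ℂ => z.2) (ContinuousLinearMap.snd ℝ ℂ ℂ) z :=
    hasFDerivAt_snd
  have c1 : HasFDerivAt (fun z : ℂ × ℂ => conj z.1)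
      ((Complex.conjCLE : ℂ →L[ℝ] ℂ).comp (ContinuousLinearMap.fst ℝ ℂ ℂ)) z :=
    ((Complex.conjCLE : ℂ →L[ℝ] ℂ).comp (ContinuousLinearMap.fst ℝ ℂ ℂ)).hasFDerivAt
  have c2 : HasFDerivAt (fun z : ℂ × ℂ => conj z.2)
      ((Complex.conjCLE : ℂ →L[ℝ] ℂ).comp (ContinuousLinearMap.snd ℝ ℂ ℂ)) z :=
    ((Complex.conjCLE : ℂ →L[ℝ] ℂ).comp (ContinuousLinearMap.snd ℝ ℂ ℂ)).hasFDerivAt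
  have h := ((h2.fun_mul c1).fun_mul (c2.pow 2)).fun_add
    (((h1.const_mul Complex.I).fun_mul (c1.pow 2)).fun_mul c2)
  unfold wirtingerBarFst wirtingerBarSnd
  rw [h.fderiv]
  constructor <;> simp <;> ring_nf <;> simp only [Complex.I_sq, Complex.I_pow_three] <;> ring

/-- For `P(z₁,z₂) = z₂ z̄₁ z̄₂² + i z₁ z̄₁² z̄₂` and any `(z₁,z₂) ≠ (0,0)`, the two
vectors `(z₁,z₂)` and `(∂P/∂z̄₁, ∂P/∂z̄₂)(z₁,z₂)` in `ℂ²` are linearly independent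
over `ℂ`. -/
theorem vectors_linearIndependent
    (P : ℂ × ℂ → ℂ)
    (hP : P = fun z =>
      z.2 * conj z.1 * (conj z.2) ^ 2 + Complex.I * z.1 * (conj z.1) ^ 2 * conj z.2) :
    ∀ z : ℂ × ℂ, z ≠ 0 →
      LinearIndependent ℂ ![z, (wirtingerBarFst P z, wirtingerBarSnd P z)] := by
  subst hP
  intro z hz
  obtain ⟨e1, e2⟩ := wirtingerBar_polynomial z
  rw [e1, e2, LinearIndependent.pair_iff' hz]
  rintro c hc
  have hc1 := congrArg Prod.fst hc
  have hc2 := congrArg Prod.snd hc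
  simp only [Prod.smul_fst, Prod.smul_snd, smul_eq_mul] at hc1 hc2
  have hdet : (2 * (z.1 * conj z.1) * (z.2 * conj z.2) - (z.2 * conj z.2) ^ 2) +
      ((z.1 * conj z.1) ^ 2 - 2 * (z.1 * conj z.1) * (z.2 * conj z.2)) * Complex.I = 0 := by
    linear_combination z.2 * hc1 - z.1 * hc2
  rw [Complex.mul_conj, Complex.mul_conj] at hdet
  generalize ha : Complex.normSq z.1 = a at hdet
  generalize hb : Complex.normSq z.2 = b at hdet
  have hre : 2 * a * b - b ^ 2 = 0 := by
    simpa [← Complex.ofReal_pow] using congrArg Complex.re hdet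
  have him : a ^ 2 - 2 * a * b = 0 := by
    simpa [← Complex.ofReal_pow] using congrArg Complex.im hdet
  have hb0 : b = 0 := by
    by_contra hb0
    have hab : b = 2 * a := mul_left_cancel₀ hb0 (by linear_combination -hre)
    subst hab
    have ha2 : a ^ 2 = 0 := by linear_combination -him / 3
    simp_all
  have ha0 : a = 0 := by simpa [hb0] using him
  exact hz (Prod.ext (Complex.normSq_eq_zero.mp (ha.trans ha0))
    (Complex.normSq_eq_zero.mp (hb.trans hb0)))
end

section
/- Let n ≥ 1, let P : ℂ² → ℂ be defined by P(x, y) = y·conj(x)·conj(y)² + i·x·conj(x)²·conj(y), and let Q : ℂ^{2n} → ℂ be defined by Q(z₁, …, z_{2n}) = Σ_{k=1}^{n} P(z_{2k-1}, z_{2k}). Then for every z = (z₁, …, z_{2n}) ∈ ℂ^{2n} with z ≠ 0, the two vectors z and (∂Q/∂z̄)(z) = ((∂Q/∂z̄₁)(z), …, (∂Q/∂z̄_{2n})(z)) in ℂ^{2n} are linearly independent over ℂ, where ∂Q/∂z̄_j denotes the conjugate Wirtinger derivative of Q with respect to the j-th coordinate. -/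
open ComplexConjugate

/-- The conjugate Wirtinger derivative
`∂g/∂z̄_j (z) = (1/2)(Dg(z)(e_j) + i · Dg(z)(i·e_j))` of a function `g : ℂ^m → ℂ`,
where `D` is the real Fréchet derivative and `e_j` the `j`-th standard basis
vector. -/
noncomputable def wirtingerBar {m : ℕ} (g : (Fin m → ℂ) → ℂ) (z : Fin m → ℂ)
    (j : Fin m) : ℂ :=
  (1 / 2 : ℂ) * (fderiv ℝ g z (Pi.single j 1) + Complex.I * fderiv ℝ g z (Pi.single j Complex.I))

/-- The real differential of `(x, y) ↦ y x̄ ȳ² + i x x̄² ȳ` in the direction `(u, v)`. -/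
noncomputable def quarticDeriv (x y u v : ℂ) : ℂ :=
  v * conj x * (conj y) ^ 2 + y * conj u * (conj y) ^ 2 + 2 * y * conj x * conj y * conj v
    + Complex.I * (u * (conj x) ^ 2 * conj y + 2 * x * conj x * conj u * conj y
      + x * (conj x) ^ 2 * conj v)

theorem exists_hasFDerivAt_quartic {m : ℕ} (a b : Fin m) (z : Fin m → ℂ) :
    ∃ L : (Fin m → ℂ) →L[ℝ] ℂ,
      HasFDerivAt (fun z : Fin m → ℂ => z b * conj (z a) * (conj (z b)) ^ 2
        + Complex.I * z a * (conj (z a)) ^ 2 * conj (z b)) L z ∧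
      ∀ v, L v = quarticDeriv (z a) (z b) (v a) (v b) := by
  have hcoord (c : Fin m) : HasFDerivAt (fun z : Fin m → ℂ => z c)
      (ContinuousLinearMap.proj (R := ℝ) (φ := fun _ : Fin m => ℂ) c) z :=
    hasFDerivAt_apply c z
  have hconj (c : Fin m) : HasFDerivAt (fun z : Fin m → ℂ => conj (z c))
      ((Complex.conjCLE : ℂ →L[ℝ] ℂ).comp
        (ContinuousLinearMap.proj (R := ℝ) (φ := fun _ : Fin m => ℂ) c)) z :=
    (Complex.conjCLE : ℂ →L[ℝ] ℂ).hasFDerivAt.comp z (hcoord c)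
  refine ⟨_, (((hcoord b).mul (hconj a)).mul ((hconj b).pow 2)).add
    ((((hcoord a).const_mul Complex.I).mul ((hconj a).pow 2)).mul (hconj b)), fun v => ?_⟩
  simp [quarticDeriv]
  ring

theorem fderiv_sum_quartic {m n : ℕ} (a b : Fin n → Fin m) (z v : Fin m → ℂ) :
    fderiv ℝ (fun z : Fin m → ℂ => ∑ k, (z (b k) * conj (z (a k)) * (conj (z (b k))) ^ 2
      + Complex.I * z (a k) * (conj (z (a k))) ^ 2 * conj (z (b k)))) z v
      = ∑ k, quarticDeriv (z (a k)) (z (b k)) (v (a k)) (v (b k)) := by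
  choose L hL hLv using fun k => exists_hasFDerivAt_quartic (a k) (b k) z
  rw [(HasFDerivAt.fun_sum fun k _ => hL k).fderiv]
  simp [hLv]

theorem eq_zero_of_mul_wirtinger_eq {x y : ℂ}
    (h : y * (y * (conj y) ^ 2 + 2 * Complex.I * x * conj x * conj y)
      = x * (2 * y * conj x * conj y + Complex.I * x * (conj x) ^ 2)) :
    x = 0 ∧ y = 0 := by
  set a := Complex.normSq x with ha
  set b := Complex.normSq y with hb
  have hx : x * conj x = (a : ℂ) := Complex.mul_conj x
  have hy : y * conj y = (b : ℂ) := Complex.mul_conj y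
  have key : (b : ℂ) ^ 2 + 2 * Complex.I * a * b = 2 * a * b + Complex.I * a ^ 2 := by
    rw [← hx, ← hy]
    linear_combination h
  have hre := congrArg Complex.re key
  have him := congrArg Complex.im key
  simp [pow_two] at hre him
  have hab : a = 0 ∧ b = 0 := by
    rcases hre with hre | hre
    · constructor <;> nlinarith
    · exact ⟨by simpa [hre] using him, hre⟩
  exact ⟨Complex.normSq_eq_zero.mp hab.1, Complex.normSq_eq_zero.mp hab.2⟩

/-- With `P(x,y) = y x̄ ȳ² + i x x̄² ȳ` and `Q(z₁,…,z_{2n}) = ∑_{k=1}^n P(z_{2k-1}, z_{2k})`,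
for every nonzero `z ∈ ℂ^{2n}` the two vectors `z` and `(∂Q/∂z̄)(z)` are linearly
independent over `ℂ`. -/
theorem z_and_wirtingerBarQ_linearIndependent
    (n : ℕ) (hn : 1 ≤ n)
    (P : ℂ → ℂ → ℂ)
    (hP : P = fun x y =>
      y * conj x * (conj y) ^ 2 + Complex.I * x * (conj x) ^ 2 * conj y)
    (Q : (Fin (2 * n) → ℂ) → ℂ)
    (hQ : Q = fun z => ∑ k : Fin n, P (z ⟨2 * k, by omega⟩) (z ⟨2 * k + 1, by omega⟩)) :
    ∀ z : Fin (2 * n) → ℂ, z ≠ 0 →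
      LinearIndependent ℂ ![z, wirtingerBar Q z] := by
  subst hP hQ
  intro z hz
  set a : Fin n → Fin (2 * n) := fun k => ⟨2 * k, by omega⟩ with ha
  set b : Fin n → Fin (2 * n) := fun k => ⟨2 * k + 1, by omega⟩ with hb
  have haa (k l : Fin n) : a k = a l ↔ k = l := by simp [ha, Fin.ext_iff]
  have hbb (k l : Fin n) : b k = b l ↔ k = l := by simp [hb, Fin.ext_iff]
  have hab (k l : Fin n) : a k ≠ b l := by simp only [ha, hb, ne_eq, Fin.ext_iff]; omega
  set w := wirtingerBar (fun z : Fin (2 * n) → ℂ => ∑ k : Fin n,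
    (z (b k) * conj (z (a k)) * (conj (z (b k))) ^ 2
      + Complex.I * z (a k) * (conj (z (a k))) ^ 2 * conj (z (b k)))) z with hw
  change LinearIndependent ℂ ![z, w]
  have hI := Complex.I_sq
  have hwa (k : Fin n) : w (a k) = z (b k) * (conj (z (b k))) ^ 2
      + 2 * Complex.I * z (a k) * conj (z (a k)) * conj (z (b k)) := by
    rw [hw, wirtingerBar, fderiv_sum_quartic, fderiv_sum_quartic,
      Finset.sum_eq_single k, Finset.sum_eq_single k]
    · simp [quarticDeriv, (hab _ _).symm]
      grind
    all_goals simp +contextual [quarticDeriv, (hab _ _).symm, haa]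
  have hwb (k : Fin n) : w (b k) = 2 * z (b k) * conj (z (a k)) * conj (z (b k))
      + Complex.I * z (a k) * (conj (z (a k))) ^ 2 := by
    rw [hw, wirtingerBar, fderiv_sum_quartic, fderiv_sum_quartic,
      Finset.sum_eq_single k, Finset.sum_eq_single k]
    · simp [quarticDeriv, hab]
      grind
    all_goals simp +contextual [quarticDeriv, hab, hbb]
  rw [LinearIndependent.pair_iff]
  intro s t hst
  have hst' (j : Fin (2 * n)) : s * z j + t * w j = 0 := by simpa using congrFun hst j
  have ht : t = 0 := by
    by_contra ht
    have hpair (k : Fin n) : z (a k) = 0 ∧ z (b k) = 0 := by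
      apply eq_zero_of_mul_wirtinger_eq
      rw [← hwa, ← hwb]
      apply mul_left_cancel₀ ht
      linear_combination z (b k) * hst' (a k) - z (a k) * hst' (b k)
    refine hz (funext fun j => ?_)
    obtain ⟨k, rfl | rfl⟩ : ∃ k, j = a k ∨ j = b k := by
      refine ⟨⟨j / 2, by omega⟩, ?_⟩
      simp only [ha, hb, Fin.ext_iff]
      omega
    · exact (hpair k).1
    · exact (hpair k).2
  subst ht
  exact ⟨by simpa [hz] using hst, rfl⟩
end
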